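/- arXiv:1703.05378 — 2 statements merged into one kernel-verified Lean document; each statement's English description precedes it below -/
import Mathlib

section
/- There is a constant c > 0 such that for every n ≥ 3, every set P of n points in the plane in convex position, and every edge-ordering φ of the complete geometric graph on P, there exists a non-crossing monotone embedded complete binary tree in the complete geometric graph on P of size at least c·log log n. -/
/-- Points of the plane. -/
abbrev Pt : Type := ℝ × ℝ

/-- A set of points is in convex position if every point is a vertex of the convex hull. -/
def ConvexPosition (P : Set Pt) : Prop :=
  ∀ p ∈ P, p ∉ convexHull ℝ (P \ {p})

/-- A set of points is in general position if no three of its points are collinear. -/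
def GeneralPosition (P : Set Pt) : Prop :=
  ∀ p ∈ P, ∀ q ∈ P, ∀ r ∈ P, p ≠ q → q ≠ r → p ≠ r →
    ¬ Collinear ℝ ({p, q, r} : Set Pt)

/-- Two closed segments `[a,b]` and `[c,d]` intersect in at most a common endpoint. -/
def NoCross (a b c d : Pt) : Prop :=
  ∀ x ∈ segment ℝ a b, x ∈ segment ℝ c d → ((x = a ∨ x = b) ∧ (x = c ∨ x = d))

/-- `φ` is an edge-ordering of the complete geometric graph on `P`:
a symmetric real labelling of pairs of points, injective on unordered pairs of
distinct points of `P`. -/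
def EdgeOrderOn (P : Finset Pt) (φ : Pt → Pt → ℝ) : Prop :=
  (∀ p q : Pt, φ p q = φ q p) ∧
  ∀ p ∈ P, ∀ q ∈ P, ∀ r ∈ P, ∀ s ∈ P, p ≠ q → r ≠ s →
    φ p q = φ r s → ({p, q} : Set Pt) = {r, s}

/-- A non-crossing path of length `k` (that is, with `k` edges) in the
complete geometric graph on `P`: a sequence of `k+1` distinct points of `P`
any two of whose edges intersect in at most a common endpoint. -/
def IsNCPath (P : Finset Pt) (k : ℕ) (v : Fin (k + 1) → Pt) : Prop :=
  (∀ i, v i ∈ P) ∧ Function.Injective v ∧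
  ∀ i j : Fin k, i ≠ j →
    NoCross (v i.castSucc) (v i.succ) (v j.castSucc) (v j.succ)

/-- The edge labels along the path are strictly increasing or strictly decreasing. -/
def PathMonotone (φ : Pt → Pt → ℝ) (k : ℕ) (v : Fin (k + 1) → Pt) : Prop :=
  StrictMono (fun i : Fin k => φ (v i.castSucc) (v i.succ)) ∨
  StrictAnti (fun i : Fin k => φ (v i.castSucc) (v i.succ))

/-- The number of vertices of a complete binary tree of height `h`. -/
def treeSize (h : ℕ) : ℕ := 2 ^ (h + 1) - 1

/-- Parent of a vertex in the heap indexing of a complete binary tree: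
the root is `0` and the children of `i` are `2*i+1` and `2*i+2`. -/
def par (j : ℕ) : ℕ := (j - 1) / 2

/-- An embedding of the complete binary tree of height `h` (in heap indexing) into
the point set `P`: an assignment of the `2^(h+1) - 1` tree vertices to distinct
points of `P`. -/
def TreeEmbed (P : Finset Pt) (h : ℕ) (t : ℕ → Pt) : Prop :=
  (∀ i < treeSize h, t i ∈ P) ∧
  ∀ i < treeSize h, ∀ j < treeSize h, t i = t j → i = j

/-- The embedded complete binary tree of height `h` is non-crossing: any two of
its (drawn) edges intersect in at most a common endpoint.  The edge leading to a
non-root vertex `i` is the segment from `t (par i)` to `t i`. -/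
def TreeNonCross (h : ℕ) (t : ℕ → Pt) : Prop :=
  ∀ i, 1 ≤ i → i < treeSize h → ∀ j, 1 ≤ j → j < treeSize h → i ≠ j →
    NoCross (t (par i)) (t i) (t (par j)) (t j)

/-- The embedded tree is increasing: along every root-to-leaf path the labels are
strictly increasing.  Equivalently (in a complete binary tree), for every vertex `j`
at depth at least two, the label of the edge above its parent is smaller than the
label of the edge above `j`. -/
def TreeIncreasing (φ : Pt → Pt → ℝ) (h : ℕ) (t : ℕ → Pt) : Prop :=
  ∀ j, 3 ≤ j → j < treeSize h →
    φ (t (par (par j))) (t (par j)) < φ (t (par j)) (t j)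

/-- The embedded tree is decreasing: along every root-to-leaf path the labels are
strictly decreasing. -/
def TreeDecreasing (φ : Pt → Pt → ℝ) (h : ℕ) (t : ℕ → Pt) : Prop :=
  ∀ j, 3 ≤ j → j < treeSize h →
    φ (t (par j)) (t j) < φ (t (par (par j))) (t (par j))

/-- The embedded tree is monotone: it is increasing or decreasing. -/
def TreeMonotone (φ : Pt → Pt → ℝ) (h : ℕ) (t : ℕ → Pt) : Prop :=
  TreeIncreasing φ h t ∨ TreeDecreasing φ h t


/-! ### Ramsey theory -/

lemma ramsey_step {κ : Type} [Fintype κ] [DecidableEq κ] [Nonempty κ]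
    (c : ℕ → ℕ → ℕ → κ) (hκ : 2 ≤ Fintype.card κ) :
    ∀ (m : ℕ) (R A : Finset ℕ), (Fintype.card κ) ^ ((R.card + m) * m) ≤ A.card →
      ∃ T ⊆ A, T.card = m ∧ ∀ u v, (u ∈ R ∨ u ∈ T) → v ∈ T → u < v →
        ∀ x ∈ T, ∀ y ∈ T, v < x → v < y → c u v x = c u v y := by
  intro m
  induction m with
  | zero =>
    intro R A _
    exact ⟨∅, by simp, by simp, by simp⟩
  | succ m ih =>
    intro R A hA
    set q := Fintype.card κ with hq
    have hpos : 0 < A.card := lt_of_lt_of_le (by positivity) hA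
    have hne : A.Nonempty := Finset.card_pos.mp hpos
    set v := A.min' hne with hv
    have hvA : v ∈ A := A.min'_mem hne
    have hvlt : ∀ x ∈ A.erase v, v < x := by
      intro x hx
      have h1 := A.min'_le x (Finset.mem_of_mem_erase hx)
      have h2 := Finset.ne_of_mem_erase hx
      omega
    set M := q ^ ((R.card + 1 + m) * m) with hM
    have hMpos : 1 ≤ M := Nat.one_le_pow _ _ (by omega)
    have hexp : (R.card + (m + 1)) * (m + 1) = R.card + ((R.card + 1 + m) * m) + (m + 1) := by
      ring
    have hbig : q ^ R.card * (M - 1) < (A.erase v).card := by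
      rw [Finset.card_erase_of_mem hvA]
      rw [hexp, pow_add, pow_add, ← hM] at hA
      have h1 : 1 ≤ q ^ R.card := Nat.one_le_pow _ _ (by omega)
      have h2 : 2 ≤ q ^ (m + 1) := le_trans hκ (Nat.le_self_pow (by omega) q)
      obtain ⟨M', hM'⟩ : ∃ M', M = M' + 1 := ⟨M - 1, by omega⟩
      rw [hM'] at hA ⊢
      have h3 : q ^ R.card * (M' + 1) * 2 ≤ q ^ R.card * (M' + 1) * q ^ (m + 1) :=
        Nat.mul_le_mul_left _ h2
      simp only [Nat.add_sub_cancel]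
      have h4 : q ^ R.card * (M' + 1) = q ^ R.card * M' + q ^ R.card := by ring
      have h5 : 0 ≤ q ^ R.card * M' := Nat.zero_le _
      omega
    obtain ⟨k, -, hk⟩ := Finset.exists_lt_card_fiber_of_mul_lt_card_of_maps_to
      (s := A.erase v) (t := (Finset.univ : Finset (R → κ)))
      (f := fun x (u : R) => c u v x) (n := M - 1) (by simp)
      (by simpa [← hq] using hbig)
    set A' := (A.erase v).filter (fun x => (fun (u : R) => c u v x) = k) with hA'
    have hvA' : ∀ x ∈ A', x ∈ A.erase v := fun x hx => (Finset.mem_filter.mp hx).1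
    obtain ⟨T, hTA, hTc, hT⟩ := ih (insert v R) A' (by
      have h1 : (insert v R).card ≤ R.card + 1 := Finset.card_insert_le _ _
      calc q ^ (((insert v R).card + m) * m) ≤ q ^ ((R.card + 1 + m) * m) := by
            apply Nat.pow_le_pow_right (by omega)
            exact Nat.mul_le_mul_right _ (by omega)
        _ ≤ A'.card := by omega)
    have hvT : ∀ x ∈ T, v < x := fun x hx => hvlt x (hvA' x (hTA hx))
    refine ⟨insert v T, ?_, ?_, ?_⟩
    · intro x hx
      rcases Finset.mem_insert.mp hx with rfl | hx
      · exact hvA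
      · exact Finset.mem_of_mem_erase (hvA' x (hTA hx))
    · rw [Finset.card_insert_of_notMem, hTc]
      intro h
      exact lt_irrefl _ (hvT v h)
    · intro u w hu hw huw x hx y hy hwx hwy
      have hvw : v ≤ w := by
        rcases Finset.mem_insert.mp hw with h | h
        · omega
        · exact (hvT w h).le
      have hxT : x ∈ T := by
        rcases Finset.mem_insert.mp hx with h | h
        · omega
        · exact h
      have hyT : y ∈ T := by
        rcases Finset.mem_insert.mp hy with h | h
        · omega
        · exact h
      rcases Finset.mem_insert.mp hw with h | h
      · have huR : u ∈ R := by
          rcases hu with hu | hu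
          · exact hu
          · rcases Finset.mem_insert.mp hu with h' | h'
            · omega
            · have := hvT u h'
              omega
        have h1 := congrFun (Finset.mem_filter.mp (hTA hxT)).2 ⟨u, huR⟩
        have h2 := congrFun (Finset.mem_filter.mp (hTA hyT)).2 ⟨u, huR⟩
        rw [h]
        exact h1.trans h2.symm
      · refine hT u w ?_ h huw x hxT y hyT hwx hwy
        rcases hu with hu | hu
        · exact Or.inl (Finset.mem_insert_of_mem hu)
        · rcases Finset.mem_insert.mp hu with h' | h'
          · exact Or.inl (by rw [h']; exact Finset.mem_insert_self _ _)
          · exact Or.inr h'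

lemma ramsey_pairs {κ : Type} [Fintype κ] [DecidableEq κ] [Nonempty κ]
    (d : ℕ → ℕ → κ) (hκ : 2 ≤ Fintype.card κ) :
    ∀ (N : ℕ) (e : κ → ℕ) (S : Finset ℕ), ∑ k, e k = N → (Fintype.card κ) ^ N ≤ S.card →
      ∃ (k : κ) (T : Finset ℕ), T ⊆ S ∧ T.card = e k ∧
        ∀ u ∈ T, ∀ v ∈ T, u < v → d u v = k := by
  intro N
  induction N with
  | zero =>
    intro e S he _
    obtain ⟨k⟩ := ‹Nonempty κ›
    refine ⟨k, ∅, by simp, ?_, by simp⟩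
    have : e k ≤ ∑ k, e k := Finset.single_le_sum (f := e) (by simp) (Finset.mem_univ k)
    simp
    omega
  | succ N ih =>
    intro e S he hS
    by_cases h0 : ∃ k, e k = 0
    · obtain ⟨k, hk⟩ := h0
      exact ⟨k, ∅, by simp, by simp [hk], by simp⟩
    push Not at h0
    set q := Fintype.card κ with hq
    have hpos : 0 < S.card := lt_of_lt_of_le (by positivity) hS
    have hne : S.Nonempty := Finset.card_pos.mp hpos
    set v := S.min' hne with hv
    have hvS : v ∈ S := S.min'_mem hne
    have hvlt : ∀ x ∈ S.erase v, v < x := by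
      intro x hx
      have h1 := S.min'_le x (Finset.mem_of_mem_erase hx)
      have h2 := Finset.ne_of_mem_erase hx
      omega
    have hMpos : 1 ≤ q ^ N := Nat.one_le_pow _ _ (by omega)
    have hbig : q * (q ^ N - 1) < (S.erase v).card := by
      rw [Finset.card_erase_of_mem hvS]
      obtain ⟨M', hM'⟩ : ∃ M', q ^ N = M' + 1 := ⟨q ^ N - 1, by omega⟩
      rw [pow_succ, hM'] at hS
      rw [hM']
      simp only [Nat.add_sub_cancel]
      have : (M' + 1) * q = q * M' + q := by ring
      omega
    obtain ⟨k, -, hk⟩ := Finset.exists_lt_card_fiber_of_mul_lt_card_of_maps_to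
      (s := S.erase v) (t := (Finset.univ : Finset κ))
      (f := fun x => d v x) (n := q ^ N - 1) (by simp)
      (by simpa [← hq] using hbig)
    have hsum : ∑ j, (Function.update e k (e k - 1)) j = N := by
      rw [Finset.sum_update_of_mem (Finset.mem_univ k)]
      have := Finset.add_sum_erase Finset.univ e (Finset.mem_univ k)
      rw [Finset.sdiff_singleton_eq_erase]
      have := h0 k
      omega
    obtain ⟨k', T, hTS, hTc, hT⟩ := ih (Function.update e k (e k - 1)) _ hsum
      (show q ^ N ≤ ((S.erase v).filter (fun x => d v x = k)).card by omega)
    have hTS' : T ⊆ S := fun x hx =>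
      Finset.mem_of_mem_erase (Finset.mem_filter.mp (hTS hx)).1
    have hvT : ∀ x ∈ T, v < x := fun x hx => hvlt x (Finset.mem_filter.mp (hTS hx)).1
    by_cases hkk : k' = k
    · subst hkk
      rw [Function.update_self] at hTc
      refine ⟨k', insert v T, ?_, ?_, ?_⟩
      · intro x hx
        rcases Finset.mem_insert.mp hx with h | h
        · rw [h]; exact hvS
        · exact hTS' h
      · rw [Finset.card_insert_of_notMem, hTc]
        · have := h0 k'
          omega
        · intro h
          exact lt_irrefl _ (hvT v h)
      · intro u hu w hw huw
        have hwT : w ∈ T := by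
          rcases Finset.mem_insert.mp hw with h | h
          · rcases Finset.mem_insert.mp hu with h' | h'
            · omega
            · have := hvT u h'
              omega
          · exact h
        rcases Finset.mem_insert.mp hu with h' | h'
        · rw [h']; exact (Finset.mem_filter.mp (hTS hwT)).2
        · exact hT u h' w hwT huw
    · rw [Function.update_of_ne hkk] at hTc
      exact ⟨k', T, hTS', hTc, hT⟩

lemma ramsey_triples (c : ℕ → ℕ → ℕ → Bool × Bool) (s n : ℕ) (hn : 4 ^ (65536 ^ s) ≤ n) :
    ∃ (k : Bool × Bool) (f : ℕ → ℕ), (∀ i < s, f i < n) ∧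
      (∀ i j, i < j → j < s → f i < f j) ∧
      ∀ i j l, i < j → j < l → l < s → c (f i) (f j) (f l) = k := by
  classical
  have hc : Fintype.card (Bool × Bool) = 4 := by simp
  obtain ⟨T, hTA, hTc, hT⟩ := ramsey_step c (by rw [hc]; norm_num) (256 ^ s) ∅ (Finset.range n) (by
    rw [hc, Finset.card_empty, zero_add, Finset.card_range, ← mul_pow]
    exact hn)
  let d : ℕ → ℕ → Bool × Bool := fun u v =>
    if h : ∃ x ∈ T, v < x then c u v h.choose else (true, true)
  obtain ⟨k, H, hHT, hHc, hH⟩ := ramsey_pairs d (by rw [hc]; norm_num) (4 * s) (fun _ => s) T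
    (by simp) (by
      rw [hc, hTc, pow_mul]
      norm_num)
  refine ⟨k, fun i => if h : i < s then H.orderEmbOfFin hHc ⟨i, h⟩ else 0, ?_, ?_, ?_⟩
  · intro i hi
    simp only [hi, dite_true]
    exact Finset.mem_range.mp (hTA (hHT (H.orderEmbOfFin_mem hHc _)))
  · intro i j hij hj
    have hi : i < s := by omega
    simp only [hi, hj, dite_true]
    exact (H.orderEmbOfFin hHc).strictMono hij
  · intro i j l hij hjl hl
    have hj : j < s := by omega
    have hi : i < s := by omega
    simp only [hi, hj, hl, dite_true]
    have mi := H.orderEmbOfFin_mem hHc ⟨i, hi⟩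
    have mj := H.orderEmbOfFin_mem hHc ⟨j, hj⟩
    have ml := H.orderEmbOfFin_mem hHc ⟨l, hl⟩
    have lij : H.orderEmbOfFin hHc ⟨i, hi⟩ < H.orderEmbOfFin hHc ⟨j, hj⟩ :=
      (H.orderEmbOfFin hHc).strictMono hij
    have ljl : H.orderEmbOfFin hHc ⟨j, hj⟩ < H.orderEmbOfFin hHc ⟨l, hl⟩ :=
      (H.orderEmbOfFin hHc).strictMono hjl
    generalize H.orderEmbOfFin hHc ⟨i, hi⟩ = u at *
    generalize H.orderEmbOfFin hHc ⟨j, hj⟩ = v at *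
    generalize H.orderEmbOfFin hHc ⟨l, hl⟩ = x at *
    have h1 := hH u mi v mj lij
    have hex : ∃ x ∈ T, v < x := ⟨x, hHT ml, ljl⟩
    simp only [d, hex, dite_true] at h1
    rw [← h1]
    exact hT u v (Or.inr (hHT mi)) (hHT mj) lij x (hHT ml) _ hex.choose_spec.1 ljl hex.choose_spec.2

/-! ### Preorder numbering of the heap -/

/-- Depth of a heap vertex. -/
def hdepth (i : ℕ) : ℕ := Nat.log 2 (i + 1)

/-- Preorder number of a heap vertex. -/
def preo (h : ℕ) : ℕ → ℕ
  | 0 => 0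
  | n + 1 => if n % 2 = 0 then preo h (n / 2) + 1
      else preo h (n / 2) + 2 ^ (h - hdepth (n / 2))
  decreasing_by all_goals omega

/-- End of the preorder interval. -/
def prend (h i : ℕ) : ℕ := preo h i + (2 ^ (h + 1 - hdepth i) - 1)

lemma hdepth_child1 (i : ℕ) : hdepth (2 * i + 1) = hdepth i + 1 := by
  unfold hdepth
  rw [show 2 * i + 1 + 1 = (i + 1) * 2 by ring, Nat.log_mul_base (by norm_num) (by omega)]

lemma hdepth_child2 (i : ℕ) : hdepth (2 * i + 2) = hdepth i + 1 := by
  unfold hdepth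
  rw [Nat.log_of_one_lt_of_le (by norm_num) (by omega),
    show (2 * i + 2 + 1) / 2 = i + 1 by omega]

lemma hdepth_par (i : ℕ) (hi : 1 ≤ i) : hdepth i = hdepth (par i) + 1 := by
  rcases Nat.even_or_odd' i with ⟨k, rfl | rfl⟩
  · obtain ⟨k, rfl⟩ : ∃ k', k = k' + 1 := ⟨k - 1, by omega⟩
    have : par (2 * (k + 1)) = k := by unfold par; omega
    rw [this, ← hdepth_child2]; rfl
  · have : par (2 * k + 1) = k := by unfold par; omega
    rw [this, ← hdepth_child1]

lemma preo_child1 (h i : ℕ) : preo h (2 * i + 1) = preo h i + 1 := by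
  rw [preo]
  have h1 : 2 * i % 2 = 0 := by omega
  have h2 : 2 * i / 2 = i := by omega
  simp [h2]

lemma preo_child2 (h i : ℕ) : preo h (2 * i + 2) = preo h i + 2 ^ (h - hdepth i) := by
  rw [show 2 * i + 2 = (2 * i + 1) + 1 by rfl, preo]
  have h1 : (2 * i + 1) % 2 = 1 := by omega
  have h2 : (2 * i + 1) / 2 = i := by omega
  simp [h1, h2]

lemma child_facts (h i : ℕ) (hi : hdepth i < h) :
    prend h (2 * i + 1) = preo h (2 * i + 2) ∧ prend h (2 * i + 2) = prend h i ∧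
    preo h i < preo h (2 * i + 1) ∧ preo h (2 * i + 1) < prend h (2 * i + 1) ∧
    preo h (2 * i + 2) < prend h (2 * i + 2) := by
  unfold prend
  rw [preo_child1, preo_child2, hdepth_child1, hdepth_child2]
  obtain ⟨e, rfl⟩ : ∃ e, h = hdepth i + 1 + e := ⟨h - hdepth i - 1, by omega⟩
  rw [show hdepth i + 1 + e + 1 - (hdepth i + 1) = e + 1 by omega,
    show hdepth i + 1 + e - hdepth i = e + 1 by omega,
    show hdepth i + 1 + e + 1 - hdepth i = e + 2 by omega]
  have : 1 ≤ 2 ^ e := Nat.one_le_two_pow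
  have h1 : 2 ^ (e + 1) = 2 * 2 ^ e := by ring
  have h2 : 2 ^ (e + 2) = 4 * 2 ^ e := by ring
  omega

lemma child_cases (j : ℕ) (hj : 1 ≤ j) : j = 2 * par j + 1 ∨ j = 2 * par j + 2 := by
  unfold par; omega

lemma child_in (h j : ℕ) (hj : 1 ≤ j) (hd : hdepth j ≤ h) :
    preo h (par j) < preo h j ∧ preo h j < prend h j ∧ prend h j ≤ prend h (par j) := by
  have h1 := hdepth_par j hj
  have h2 := child_facts h (par j) (by omega)
  rcases child_cases j hj with h3 | h3 <;> rw [← h3] at h2 <;> omega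

lemma same_depth (h : ℕ) : ∀ (j i : ℕ), i < j → hdepth i = hdepth j → hdepth j ≤ h →
    prend h i ≤ preo h j := by
  intro j
  induction j using Nat.strong_induction_on with
  | _ j ih =>
    intro i hij hd hh
    have hj1 : 1 ≤ j := by omega
    have hi1 : 1 ≤ i := by
      by_contra h0
      have : i = 0 := by omega
      subst this
      have h1 := hdepth_par j hj1
      have : hdepth 0 = 0 := by simp [hdepth]
      omega
    have di := hdepth_par i hi1
    have dj := hdepth_par j hj1
    have ci := child_in h i hi1 (by omega)
    have cj := child_in h j hj1 (by omega)
    have hpp : par i ≤ par j := by unfold par; omega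
    rcases hpp.lt_or_eq with hlt | heq
    · have := ih (par j) (by unfold par; omega) (par i) hlt (by omega) (by omega)
      omega
    · have h2 := child_facts h (par j) (by omega)
      have h3 := child_cases i hi1
      have h4 := child_cases j hj1
      rw [heq] at h3
      have h5 : i = 2 * par j + 1 := by omega
      have h6 : j = 2 * par j + 2 := by omega
      rw [← h5, ← h6] at h2
      omega

lemma laminar (h : ℕ) : ∀ (j i : ℕ), i < j → hdepth j ≤ h →
    (preo h i < preo h j ∧ prend h j ≤ prend h i) ∨ prend h i ≤ preo h j ∨
      prend h j ≤ preo h i := by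
  intro j
  induction j using Nat.strong_induction_on with
  | _ j ih =>
    intro i hij hd
    have hj1 : 1 ≤ j := by omega
    have dj := hdepth_par j hj1
    have cj := child_in h j hj1 (by omega)
    rcases lt_trichotomy i (par j) with hlt | heq | hgt
    · have := ih (par j) (by unfold par; omega) i hlt (by omega)
      omega
    · rw [heq]
      left; omega
    · have hm1 : hdepth (par j) ≤ hdepth i := Nat.log_mono_right (by omega)
      have hm2 : hdepth i ≤ hdepth j := Nat.log_mono_right (by omega)
      rcases hm2.lt_or_eq with h1 | h1
      · have := same_depth h i (par j) hgt (by omega) (by omega)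
        omega
      · have := same_depth h j i hij h1 hd
        omega

lemma depth_le (h i : ℕ) (hi : i < treeSize h) : hdepth i ≤ h := by
  unfold hdepth
  unfold treeSize at hi
  have : Nat.log 2 (i + 1) < h + 1 := Nat.log_lt_of_lt_pow (by omega) (by omega)
  omega

lemma preo_lt_prend (h i : ℕ) (hi : i < treeSize h) : preo h i < prend h i := by
  have := depth_le h i hi
  unfold prend
  have : 2 ≤ 2 ^ (h + 1 - hdepth i) := Nat.le_self_pow (by omega) 2
  omega

lemma preo_lt (h i : ℕ) (hi : i < treeSize h) : prend h i ≤ treeSize h := by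
  have h0 : prend h 0 = treeSize h := by
    simp [prend, preo, treeSize, hdepth]
  induction i using Nat.strong_induction_on with
  | _ i ih =>
    rcases Nat.eq_zero_or_pos i with rfl | hp
    · omega
    · have h1 := child_in h i hp (depth_le h i hi)
      have h2 : par i < i := by unfold par; omega
      have := ih (par i) h2 (by omega)
      omega

/-! ### Geometry -/

/-- Orientation determinant. -/
def ori (a b c : Pt) : ℝ := (b.1 - a.1) * (c.2 - a.2) - (b.2 - a.2) * (c.1 - a.1)

lemma ori_seg (a b c d x : Pt) (s t : ℝ) (hst : s + t = 1) (hx : s • c + t • d = x) :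
    ori a b x = s * ori a b c + t * ori a b d := by
  subst hx
  have : s = 1 - t := by linarith
  subst this
  simp only [ori, Prod.fst_add, Prod.snd_add, Prod.smul_fst, Prod.smul_snd, smul_eq_mul]
  ring

lemma ori_left (a b : Pt) : ori a b a = 0 := by simp [ori]
lemma ori_right (a b : Pt) : ori a b b = 0 := by simp only [ori]; ring

lemma ori_self (a b x : Pt) (hx : x ∈ segment ℝ a b) : ori a b x = 0 := by
  obtain ⟨s, t, _, _, hst, rfl⟩ := hx
  rw [ori_seg a b a b _ s t hst rfl, ori_left, ori_right]
  ring

lemma noCross_symm {a b c d : Pt} (h : NoCross a b c d) : NoCross c d a b :=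
  fun x h1 h2 => (h x h2 h1).symm

lemma noCross_side {a b c d : Pt} (h : 0 < ori a b c * ori a b d) : NoCross a b c d := by
  intro x hx hx'
  exfalso
  have h0 := ori_self a b x hx
  obtain ⟨s, t, hs, ht, hst, hx⟩ := hx'
  rw [ori_seg a b c d x s t hst hx] at h0
  rcases pos_and_pos_or_neg_and_neg_of_mul_pos h with ⟨h1, h2⟩ | ⟨h1, h2⟩
  · rcases hs.lt_or_eq with hs' | hs'
    · have := mul_pos hs' h1
      have := mul_nonneg ht h2.le
      linarith
    · have : t = 1 := by linarith
      subst this; subst hs'; linarith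
  · rcases hs.lt_or_eq with hs' | hs'
    · have := mul_neg_of_pos_of_neg hs' h1
      have := mul_nonpos_of_nonneg_of_nonpos ht h2.le
      linarith
    · have : t = 1 := by linarith
      subst this; subst hs'; linarith

/-- Segments sharing an endpoint (the first one of `[c,d]`), not collinear. -/
lemma noCross_share {a b c d : Pt} (hc : c = a ∨ c = b) (h : ori a b d ≠ 0) :
    NoCross a b c d := by
  intro x hx hx'
  have h0 := ori_self a b x hx
  obtain ⟨s, t, hs, ht, hst, hx⟩ := hx'
  rw [ori_seg a b c d x s t hst hx] at h0
  have hc0 : ori a b c = 0 := by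
    rcases hc with rfl | rfl
    · exact ori_left _ _
    · exact ori_right _ _
  rw [hc0, mul_zero, zero_add] at h0
  have ht0 : t = 0 := by
    rcases mul_eq_zero.mp h0 with h1 | h1
    · exact h1
    · exact absurd h1 h
  have hs1 : s = 1 := by linarith
  subst ht0; subst hs1
  have hxc : x = c := by rw [← hx]; simp
  subst hxc
  exact ⟨hc, Or.inl rfl⟩

lemma ori_swap (a b c : Pt) : ori a c b = - ori a b c := by simp only [ori]; ring
lemma ori_rot (a b c : Pt) : ori b c a = ori a b c := by simp only [ori]; ring

/-- Edges that do not interleave do not cross in a homogeneous sequence. -/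
lemma noCross_homog (g : ℕ → Pt) (s : ℕ) (σ : ℝ)
    (hg : ∀ i j l, i < j → j < l → l < s → 0 < σ * ori (g i) (g j) (g l))
    (u v u' v' : ℕ) (huv : u < v) (huv' : u' < v') (hv : v < s) (hv' : v' < s) (hne : v < v')
    (hcr : ¬ (u < u' ∧ u' < v)) : NoCross (g u) (g v) (g u') (g v') := by
  have hnz : ∀ i j l, i < j → j < l → l < s → ori (g i) (g j) (g l) ≠ 0 := by
    intro i j l h1 h2 h3 h4
    have := hg i j l h1 h2 h3
    rw [h4, mul_zero] at this
    exact lt_irrefl _ this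
  have key : ∀ x y : ℝ, 0 < σ * x → 0 < σ * y → 0 < x * y := by
    intro x y hx hy
    have h1 : 0 < (σ * x) * (σ * y) := mul_pos hx hy
    have h2 : (σ * x) * (σ * y) = σ ^ 2 * (x * y) := by ring
    rw [h2] at h1
    by_contra h3
    have := mul_nonpos_of_nonneg_of_nonpos (sq_nonneg σ) (not_lt.mp h3)
    linarith
  rcases lt_trichotomy u u' with h | h | h
  · have hvu : v ≤ u' := by
      by_contra h'
      exact hcr ⟨h, by omega⟩
    rcases hvu.lt_or_eq with h1 | h1
    · exact noCross_side (key _ _ (hg u v u' huv h1 (by omega)) (hg u v v' huv hne hv'))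
    · exact noCross_share (Or.inr (by rw [h1])) (hnz u v v' huv hne hv')
  · exact noCross_share (Or.inl (by rw [h])) (hnz u v v' huv hne hv')
  · skip
    apply noCross_symm
    apply noCross_side
    rw [ori_swap (g u') (g u), ori_swap (g u') (g v), neg_mul_neg]
    exact key _ _ (hg u' u v' h (by omega) hv') (hg u' v v' (by omega) hne hv')

lemma between_hull {P : Set Pt} (hP : ConvexPosition P) {a b c : Pt} (ha : a ∈ P) (hb : b ∈ P)
    (hc : c ∈ P) (hab : a ≠ b) (hcb : c ≠ b) (h : Wbtw ℝ a b c) : False := by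
  apply hP b hb
  have h1 : b ∈ segment ℝ a c := by rw [← mem_segment_iff_wbtw] at h; exact h
  exact (convex_convexHull ℝ _).segment_subset
    (subset_convexHull ℝ _ (show a ∈ P \ {b} from ⟨ha, hab⟩))
    (subset_convexHull ℝ _ (show c ∈ P \ {b} from ⟨hc, hcb⟩)) h1

lemma collinear_of_ori {a b c : Pt} (hab : a ≠ b) (h : ori a b c = 0) :
    Collinear ℝ ({a, b, c} : Set Pt) := by
  rw [collinear_iff_of_mem (p₀ := a) (by simp)]
  refine ⟨b - a, ?_⟩
  simp only [Set.mem_insert_iff, Set.mem_singleton_iff, forall_eq_or_imp, forall_eq]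
  refine ⟨⟨0, by simp⟩, ⟨1, by simp⟩, ?_⟩
  unfold ori at h
  by_cases h1 : b.1 - a.1 = 0
  · have h2 : b.2 - a.2 ≠ 0 := by
      intro h2
      exact hab (Prod.ext (by linarith) (by linarith))
    refine ⟨(c.2 - a.2) / (b.2 - a.2), ?_⟩
    rw [h1] at h
    have h3 : c.1 - a.1 = 0 := by
      rcases mul_eq_zero.mp (show (b.2 - a.2) * (c.1 - a.1) = 0 by linarith) with h4 | h4
      · exact absurd h4 h2
      · exact h4
    apply Prod.ext
    · simp [h1]; linarith
    · simp; field_simp; ring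
  · refine ⟨(c.1 - a.1) / (b.1 - a.1), ?_⟩
    apply Prod.ext
    · simp; field_simp; ring
    · simp; field_simp; linarith

lemma ori_ne {P : Set Pt} (hP : ConvexPosition P) {a b c : Pt} (ha : a ∈ P) (hb : b ∈ P)
    (hc : c ∈ P) (hab : a ≠ b) (hbc : b ≠ c) (hac : a ≠ c) : ori a b c ≠ 0 := by
  intro h
  rcases (collinear_of_ori hab h).wbtw_or_wbtw_or_wbtw with h | h | h
  · exact between_hull hP ha hb hc hab hbc.symm h
  · exact between_hull hP hb hc ha hbc hac h
  · exact between_hull hP hc ha hb hac.symm hab.symm h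

lemma tree_exists (h n : ℕ) (hn : 4 ^ (65536 ^ (2 ^ (h + 1))) ≤ n) (P : Finset Pt)
    (hPn : P.card = n) (hP : ConvexPosition ↑P) (φ : Pt → Pt → ℝ) (hφ : EdgeOrderOn P φ) :
    ∃ t : ℕ → Pt, TreeEmbed P h t ∧ TreeNonCross h t ∧ TreeMonotone φ h t := by
  classical
  let e : ℕ → Pt := fun i => if hi : i < n then ((P.equivFinOfCardEq hPn).symm ⟨i, hi⟩ : Pt) else 0
  have heP : ∀ i < n, e i ∈ P := by
    intro i hi
    simp only [e, hi, dite_true]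
    exact Subtype.coe_prop _
  have heinj : ∀ i < n, ∀ j < n, e i = e j → i = j := by
    intro i hi j hj hij
    simp only [e, hi, hj, dite_true] at hij
    have := (P.equivFinOfCardEq hPn).symm.injective (Subtype.ext hij)
    simpa using this
  obtain ⟨k, f, hfn, hfm, hfc⟩ := ramsey_triples
    (fun i j l => (decide (φ (e i) (e j) < φ (e j) (e l)), decide (0 < ori (e i) (e j) (e l))))
    (2 ^ (h + 1)) n hn
  have hs : treeSize h ≤ 2 ^ (h + 1) := Nat.sub_le _ _
  set g : ℕ → Pt := fun i => e (f i) with hgdef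
  have hgP : ∀ i < 2 ^ (h + 1), g i ∈ P := fun i hi => heP _ (hfn i hi)
  have hfne : ∀ i j, i < j → j < 2 ^ (h + 1) → g i ≠ g j := by
    intro i j hij hj heq
    have h1 := heinj _ (hfn i (by omega)) _ (hfn j hj) heq
    have h2 := hfm i j hij hj
    omega
  have hori : ∀ i j l, i < j → j < l → l < 2 ^ (h + 1) → ori (g i) (g j) (g l) ≠ 0 := by
    intro i j l h1 h2 h3
    exact ori_ne hP (hgP i (by omega)) (hgP j (by omega)) (hgP l h3) (hfne i j h1 (by omega))
      (hfne j l h2 h3) (hfne i l (by omega) h3)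
  obtain ⟨σ, hσ⟩ : ∃ σ : ℝ, ∀ i j l, i < j → j < l → l < 2 ^ (h + 1) →
      0 < σ * ori (g i) (g j) (g l) := by
    cases hk : k.2 with
    | true =>
      refine ⟨1, fun i j l h1 h2 h3 => ?_⟩
      have h4 := congrArg Prod.snd (hfc i j l h1 h2 h3)
      rw [hk] at h4
      simpa using h4
    | false =>
      refine ⟨-1, fun i j l h1 h2 h3 => ?_⟩
      have h4 := congrArg Prod.snd (hfc i j l h1 h2 h3)
      rw [hk] at h4
      have h5 : ori (g i) (g j) (g l) ≤ 0 := by simpa using h4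
      have h6 := lt_of_le_of_ne h5 (hori i j l h1 h2 h3)
      linarith
  have hpar : ∀ i, 1 ≤ i → i < treeSize h → par i < treeSize h ∧ preo h (par i) < preo h i := by
    intro i h1 h2
    exact ⟨lt_of_le_of_lt (by unfold par; omega) h2, (child_in h i h1 (depth_le h i h2)).1⟩
  have hpl : ∀ i < treeSize h, preo h i < treeSize h := fun i hi =>
    lt_of_lt_of_le (preo_lt_prend h i hi) (preo_lt h i hi)
  have hpinj : ∀ i j, i < j → j < treeSize h → preo h i ≠ preo h j := by
    intro i j hij hj
    have h1 := laminar h j i hij (depth_le h j hj)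
    have h2 := preo_lt_prend h i (by omega)
    have h3 := preo_lt_prend h j hj
    omega
  have hnoint : ∀ i j, 1 ≤ i → i < treeSize h → 1 ≤ j → j < treeSize h →
      preo h i < preo h j → ¬ (preo h (par i) < preo h (par j) ∧ preo h (par j) < preo h i) := by
    rintro i j hi1 hi hj1 hj hij ⟨h1, h2⟩
    have ci := child_in h i hi1 (depth_le h i hi)
    have cj := child_in h j hj1 (depth_le h j hj)
    have hpj := hpar j hj1 hj
    have hpi := hpar i hi1 hi
    have dpi := hdepth_par i hi1
    have di := depth_le h i hi
    have hf := child_facts h (par i) (by omega)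
    have hc1 := preo_child1 h (par i)
    rcases child_cases i hi1 with h3 | h3
    · rw [← h3] at hc1
      omega
    · rw [← h3] at hf
      have hql : 2 * par i + 1 < treeSize h := by omega
      generalize 2 * par i + 1 = q at *
      have hlq := preo_lt_prend h _ hpj.1
      rcases lt_trichotomy q (par j) with h4 | h4 | h4
      · have := laminar h (par j) q h4 (depth_le h _ hpj.1)
        omega
      · rw [← h4] at cj
        omega
      · have := laminar h q (par j) h4 (depth_le h _ hql)
        omega
  refine ⟨fun i => g (preo h i), ⟨?_, ?_⟩, ?_, ?_⟩
  · intro i hi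
    exact hgP _ (lt_of_lt_of_le (hpl i hi) hs)
  · intro i hi j hj hij
    by_contra hne
    have h1 : preo h i ≠ preo h j := by
      rcases lt_or_gt_of_ne hne with hlt | hgt
      · exact hpinj i j hlt hj
      · exact (hpinj j i hgt hi).symm
    rcases lt_or_gt_of_ne h1 with hlt | hgt
    · exact hfne _ _ hlt (lt_of_lt_of_le (hpl j hj) hs) hij
    · exact hfne _ _ hgt (lt_of_lt_of_le (hpl i hi) hs) hij.symm
  · intro i hi1 hi j hj1 hj hne
    have h1 : preo h i ≠ preo h j := by
      rcases lt_or_gt_of_ne hne with hlt | hgt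
      · exact hpinj i j hlt hj
      · exact (hpinj j i hgt hi).symm
    have li := lt_of_lt_of_le (hpl i hi) hs
    have lj := lt_of_lt_of_le (hpl j hj) hs
    rcases lt_or_gt_of_ne h1 with hlt | hgt
    · exact noCross_homog g _ σ hσ _ _ _ _ (hpar i hi1 hi).2 (hpar j hj1 hj).2 li lj hlt
        (hnoint i j hi1 hi hj1 hj hlt)
    · exact noCross_symm (noCross_homog g _ σ hσ _ _ _ _ (hpar j hj1 hj).2 (hpar i hi1 hi).2
        lj li hgt (hnoint j i hj1 hj hi1 hi hgt))
  · have hpp : ∀ j, 3 ≤ j → j < treeSize h → preo h (par (par j)) < preo h (par j) ∧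
        preo h (par j) < preo h j ∧ preo h j < 2 ^ (h + 1) := by
      intro j h3 hj
      have h1 := hpar j (by omega) hj
      have h2 := hpar (par j) (by unfold par; omega) h1.1
      exact ⟨h2.2, h1.2, lt_of_lt_of_le (hpl j hj) hs⟩
    cases hk : k.1 with
    | true =>
      left
      intro j h3 hj
      obtain ⟨h1, h2, h4⟩ := hpp j h3 hj
      have h5 := congrArg Prod.fst (hfc _ _ _ h1 h2 h4)
      rw [hk] at h5
      simpa using h5
    | false =>
      right
      intro j h3 hj
      obtain ⟨h1, h2, h4⟩ := hpp j h3 hj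
      have h5 := congrArg Prod.fst (hfc _ _ _ h1 h2 h4)
      rw [hk] at h5
      have h6 : φ (g (preo h (par j))) (g (preo h j)) ≤
        φ (g (preo h (par (par j)))) (g (preo h (par j))) := by simpa using h5
      refine lt_of_le_of_ne h6 fun heq => ?_
      have n1 := hfne _ _ h1 (h2.trans h4)
      have n2 := hfne _ _ h2 h4
      have n3 := hfne _ _ (h1.trans h2) h4
      have hset := hφ.2 _ (hgP _ (h2.trans h4)) _ (hgP _ h4) _ (hgP _ (h1.trans (h2.trans h4))) _
        (hgP _ (h2.trans h4)) n2 n1 heq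
      have : g (preo h j) ∈ ({g (preo h (par (par j))), g (preo h (par j))} : Set Pt) := by
        rw [← hset]; simp
      rcases this with h7 | h7
      · exact n3 h7.symm
      · exact n2 h7.symm

/-- There is `c > 0` such that every edge-ordering of the complete
geometric graph on any `n ≥ 3` points in convex position admits a non-crossing
monotone embedded complete binary tree of size at least `c·log log n`. -/
theorem stmt5 : ∃ c : ℝ, 0 < c ∧
    ∀ n : ℕ, 3 ≤ n → ∀ P : Finset Pt, P.card = n → ConvexPosition ↑P →
      ∀ φ : Pt → Pt → ℝ, EdgeOrderOn P φ →
        ∃ (h : ℕ) (t : ℕ → Pt),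
          TreeEmbed P h t ∧ TreeNonCross h t ∧ TreeMonotone φ h t ∧
          c * Real.log (Real.log n) ≤ (treeSize h : ℝ) := by
  have hlog : 0 < Real.log 65536 := Real.log_pos (by norm_num)
  refine ⟨1 / (8 * Real.log 65536), by positivity, ?_⟩
  intro n hn P hPn hP φ hφ
  have hex : ∃ h : ℕ, n < 4 ^ (65536 ^ (2 ^ (h + 2))) := by
    refine ⟨n, ?_⟩
    calc n < n + 2 := by omega
      _ < 2 ^ (n + 2) := Nat.lt_pow_self (by norm_num)
      _ < 65536 ^ (2 ^ (n + 2)) := Nat.lt_pow_self (by norm_num)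
      _ < _ := Nat.lt_pow_self (by norm_num)
  obtain ⟨h, hlt, hmin⟩ : ∃ h : ℕ, n < 4 ^ (65536 ^ (2 ^ (h + 2))) ∧
      (h = 0 ∨ 4 ^ (65536 ^ (2 ^ (h + 1))) ≤ n) := by
    classical
    refine ⟨Nat.find hex, Nat.find_spec hex, ?_⟩
    rcases Nat.eq_zero_or_pos (Nat.find hex) with h0 | h0
    · exact Or.inl h0
    · right
      have h1 := Nat.find_min hex (Nat.sub_lt h0 one_pos)
      rw [show Nat.find hex - 1 + 2 = Nat.find hex + 1 by omega] at h1
      exact not_lt.mp h1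
  have hT : ∃ t : ℕ → Pt, TreeEmbed P h t ∧ TreeNonCross h t ∧ TreeMonotone φ h t := by
    clear hlt
    rcases hmin with h0 | hge
    · obtain ⟨p, hp⟩ : P.Nonempty := Finset.card_pos.mp (by omega)
      have h1 : treeSize h = 1 := by rw [h0]; rfl
      refine ⟨fun _ => p, ⟨fun _ _ => hp, fun i hi j hj _ => by omega⟩,
        fun i h2 h3 => by omega, Or.inl fun j h2 h3 => by omega⟩
    · exact tree_exists h n hge P hPn hP φ hφ
  obtain ⟨t, h1, h2, h3⟩ := hT
  refine ⟨h, t, h1, h2, h3, ?_⟩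
  have hn3 : (3 : ℝ) ≤ n := by exact_mod_cast hn
  have hln : 0 < Real.log n := Real.log_pos (by linarith)
  have hb : Real.log n ≤ (65536 : ℝ) ^ (2 ^ (h + 2)) * 2 := by
    have hlt' : (n : ℝ) ≤ (4 : ℝ) ^ (65536 ^ (2 ^ (h + 2))) := by exact_mod_cast hlt.le
    have h4 := Real.log_le_log (by linarith) hlt'
    rw [Real.log_pow] at h4
    refine h4.trans ?_
    push_cast
    have h5 : Real.log 4 ≤ 2 := by
      rw [show (4 : ℝ) = 2 ^ 2 by norm_num, Real.log_pow]
      have := Real.log_two_lt_d9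
      push_cast
      linarith
    exact mul_le_mul_of_nonneg_left h5 (by positivity)
  have hb2 : Real.log (Real.log n) ≤ 2 ^ h * (8 * Real.log 65536) := by
    have h4 := Real.log_le_log hln hb
    rw [Real.log_mul (by positivity) (by norm_num), Real.log_pow] at h4
    push_cast at h4
    have h5 : Real.log 2 ≤ Real.log 65536 := Real.log_le_log (by norm_num) (by norm_num)
    have h6 : (1 : ℝ) ≤ 2 ^ h := one_le_pow₀ (by norm_num)
    have h7 : (2 : ℝ) ^ (h + 2) = 4 * 2 ^ h := by ring
    rw [h7] at h4
    nlinarith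
  have hsz : (2 : ℝ) ^ h ≤ (treeSize h : ℝ) := by
    have h4 : 2 ^ h ≤ treeSize h := by
      unfold treeSize
      have := Nat.one_le_two_pow (n := h)
      have h7 : 2 ^ (h + 1) = 2 * 2 ^ h := by ring
      omega
    exact_mod_cast h4
  refine le_trans ?_ hsz
  rw [one_div, inv_mul_le_iff₀ (by positivity), mul_comm]
  exact hb2
end

section
/- There is a constant C > 0 such that for every n ≥ 2 and every set P of n points in the plane in convex position, there exists an edge-ordering φ of the complete geometric graph on P under which every non-crossing increasing embedded complete binary tree has size at most C·log n. (Hence τ̄₊(K_n) = O(log n).) -/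
/-! ### Levels of pairs of natural numbers -/

theorem lev_exists (a b : ℕ) : ∃ k, a / 2 ^ k = b / 2 ^ k := by
  refine ⟨a + b, ?_⟩
  rw [Nat.div_eq_of_lt, Nat.div_eq_of_lt]
  · exact lt_of_lt_of_le Nat.lt_two_pow_self (Nat.pow_le_pow_right (by norm_num) (by omega))
  · exact lt_of_lt_of_le Nat.lt_two_pow_self (Nat.pow_le_pow_right (by norm_num) (by omega))

/-- The least `k` such that `a` and `b` lie in the same dyadic block of length `2 ^ k`. -/
noncomputable def lev (a b : ℕ) : ℕ := Nat.find (lev_exists a b)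

theorem lev_comm (a b : ℕ) : lev a b = lev b a := by
  unfold lev
  congr 1
  funext k
  exact propext eq_comm

theorem div_pow_mono {a b k l : ℕ} (hkl : k ≤ l) (h : a / 2 ^ k = b / 2 ^ k) :
    a / 2 ^ l = b / 2 ^ l := by
  obtain ⟨m, rfl⟩ := Nat.exists_eq_add_of_le hkl
  rw [pow_add, ← Nat.div_div_eq_div_mul, ← Nat.div_div_eq_div_mul, h]

theorem lev_spec (a b : ℕ) : a / 2 ^ lev a b = b / 2 ^ lev a b := Nat.find_spec (lev_exists a b)

theorem lev_le {a b k : ℕ} (h : a / 2 ^ k = b / 2 ^ k) : lev a b ≤ k := Nat.find_min' _ h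

theorem lev_pos {a b : ℕ} (h : a ≠ b) : 1 ≤ lev a b := by
  by_contra hc
  have h0 : lev a b = 0 := by omega
  have := lev_spec a b
  rw [h0] at this
  simp at this
  exact h this

theorem lev_le_of_lt {a b K : ℕ} (ha : a < 2 ^ K) (hb : b < 2 ^ K) : lev a b ≤ K := by
  apply lev_le
  rw [Nat.div_eq_of_lt ha, Nat.div_eq_of_lt hb]

/-- Position of two points relative to their level. -/
theorem lev_split {a b k : ℕ} (h : lev a b = k + 1) :
    a / 2 ^ k / 2 = b / 2 ^ k / 2 ∧ a / 2 ^ k ≠ b / 2 ^ k := by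
  constructor
  · have := lev_spec a b
    rw [h, pow_succ, ← Nat.div_div_eq_div_mul, ← Nat.div_div_eq_div_mul] at this
    exact this
  · intro hc
    have := lev_le hc
    omega

/-! ### Non-crossing relations on natural numbers -/

/-- A symmetric non-crossing relation. -/
def NCRel (E : ℕ → ℕ → Prop) : Prop :=
  (∀ a b, E a b → E b a) ∧ ∀ a b c d, a < b → b < c → c < d → E a c → E b d → False

theorem spider_mid_left {E : ℕ → ℕ → Prop} (hE : NCRel E) {T c d1 d2 d3 x : ℕ}
    (hc : c < T) (hx : x < T) (h1 : T ≤ d1) (h12 : d1 < d2) (h23 : d2 < d3) (hxc : x ≠ c)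
    (e1 : E c d1) (e3 : E c d3) (e2 : E d2 x) : False := by
  rcases lt_or_gt_of_ne hxc with h | h
  · exact hE.2 x c d2 d3 h (by omega) h23 (hE.1 _ _ e2) e3
  · exact hE.2 c x d1 d2 h (by omega) h12 e1 (hE.1 _ _ e2)

theorem spider_mid_right {E : ℕ → ℕ → Prop} (hE : NCRel E) {T c d1 d2 d3 x : ℕ}
    (hc : T ≤ c) (hx : T ≤ x) (h3 : d3 < T) (h12 : d1 < d2) (h23 : d2 < d3) (hxc : x ≠ c)
    (e1 : E c d1) (e3 : E c d3) (e2 : E d2 x) : False := by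
  rcases lt_or_gt_of_ne hxc with h | h
  · exact hE.2 d2 d3 x c h23 (by omega) h e2 (hE.1 _ _ e3)
  · exact hE.2 d1 d2 c x h12 (by omega) h (hE.1 _ _ e1) e2

theorem spider {E : ℕ → ℕ → Prop} (hE : NCRel E) {T c d1 d2 d3 x1 x2 x3 : ℕ}
    (hside : (c < T ∧ x1 < T ∧ x2 < T ∧ x3 < T ∧ T ≤ d1 ∧ T ≤ d2 ∧ T ≤ d3) ∨
      (T ≤ c ∧ T ≤ x1 ∧ T ≤ x2 ∧ T ≤ x3 ∧ d1 < T ∧ d2 < T ∧ d3 < T))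
    (h12 : d1 ≠ d2) (h13 : d1 ≠ d3) (h23 : d2 ≠ d3)
    (hx1 : x1 ≠ c) (hx2 : x2 ≠ c) (hx3 : x3 ≠ c)
    (e1 : E c d1) (e2 : E c d2) (e3 : E c d3)
    (f1 : E d1 x1) (f2 : E d2 x2) (f3 : E d3 x3) : False := by
  rcases hside with ⟨hc, y1, y2, y3, g1, g2, g3⟩ | ⟨hc, y1, y2, y3, g1, g2, g3⟩ <;>
  rcases lt_or_gt_of_ne h12 with a | a <;> rcases lt_or_gt_of_ne h13 with b | b <;>
    rcases lt_or_gt_of_ne h23 with d | d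
  · exact spider_mid_left hE hc y2 g1 a d hx2 e1 e3 f2
  · exact spider_mid_left hE hc y3 g1 b d hx3 e1 e2 f3
  · omega
  · exact spider_mid_left hE hc y1 g3 b a hx1 e3 e2 f1
  · exact spider_mid_left hE hc y1 g2 a b hx1 e2 e3 f1
  · omega
  · exact spider_mid_left hE hc y3 g2 d b hx3 e2 e1 f3
  · exact spider_mid_left hE hc y2 g3 d a hx2 e3 e1 f2
  · exact spider_mid_right hE hc y2 g3 a d hx2 e1 e3 f2
  · exact spider_mid_right hE hc y3 g2 b d hx3 e1 e2 f3
  · omega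
  · exact spider_mid_right hE hc y1 g2 b a hx1 e3 e2 f1
  · exact spider_mid_right hE hc y1 g3 a b hx1 e2 e3 f1
  · omega
  · exact spider_mid_right hE hc y3 g1 d b hx3 e2 e1 f3
  · exact spider_mid_right hE hc y2 g1 d a hx2 e3 e1 f2

/-! ### The combinatorial core -/

/-- Level of the edge above vertex `i`. -/
noncomputable def elev (u : ℕ → ℕ) (i : ℕ) : ℕ := lev (u (par i)) (u i)

theorem root_block {u : ℕ → ℕ} {N : ℕ}
    (hmono : ∀ j, 3 ≤ j → j < N → elev u (par j) ≤ elev u j) :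
    ∀ i, 1 ≤ i → i < N → u i / 2 ^ elev u i = u 0 / 2 ^ elev u i := by
  intro i
  induction i using Nat.strong_induction_on with
  | _ i ih =>
    intro h1 hN
    have hs : u (par i) / 2 ^ elev u i = u i / 2 ^ elev u i := lev_spec _ _
    by_cases h3 : 3 ≤ i
    · have hp : par i < i := by unfold par; omega
      have hp1 : 1 ≤ par i := by unfold par; omega
      have := ih (par i) hp hp1 (by omega)
      rw [← hs]
      exact div_pow_mono (hmono i h3 hN) this
    · have : par i = 0 := by unfold par; omega
      rw [← hs, this]

theorem special_unique {u : ℕ → ℕ} {N : ℕ} {E : ℕ → ℕ → Prop} (hE : NCRel E)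
    (hinj : ∀ i < N, ∀ j < N, u i = u j → i = j)
    (hedge : ∀ i, 1 ≤ i → i < N → E (u (par i)) (u i))
    (hmono : ∀ j, 3 ≤ j → j < N → elev u (par j) ≤ elev u j)
    {x y cx cy k : ℕ} (hx1 : 1 ≤ x) (hxN : x < N) (hy1 : 1 ≤ y) (hyN : y < N)
    (hcx : 3 ≤ cx) (hcxN : cx < N) (hpx : par cx = x)
    (hcy : 3 ≤ cy) (hcyN : cy < N) (hpy : par cy = y)
    (hlx : elev u x = k + 1) (hly : elev u y = k + 1)
    (hlcx : k + 1 < elev u cx) (hlcy : k + 1 < elev u cy)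
    (hside : u x / 2 ^ k % 2 = u y / 2 ^ k % 2) : x = y := by
  by_contra hxy
  have hrx := root_block hmono x hx1 hxN
  have hry := root_block hmono y hy1 hyN
  rw [hlx] at hrx
  rw [hly] at hry
  have hb : u x / 2 ^ (k + 1) = u y / 2 ^ (k + 1) := hrx.trans hry.symm
  rw [pow_succ, ← Nat.div_div_eq_div_mul, ← Nat.div_div_eq_div_mul] at hb
  have hq : u x / 2 ^ k = u y / 2 ^ k := by omega
  obtain ⟨px, px'⟩ := lev_split hlx
  obtain ⟨py, py'⟩ := lev_split hly
  have out : ∀ z c, par c = z → k + 1 < elev u c → u c / 2 ^ k / 2 ≠ u z / 2 ^ k / 2 := by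
    intro z c hz hl he
    rw [Nat.div_div_eq_div_mul, Nat.div_div_eq_div_mul, ← pow_succ] at he
    have := lev_le he
    rw [lev_comm, ← hz] at this
    unfold elev at hl
    omega
  have ox := out x cx hpx hlcx
  have oy := out y cy hpy hlcy
  have lt_of : ∀ {a b : ℕ}, a / 2 ^ k < b / 2 ^ k → a < b := by
    intro a b h
    by_contra hc
    have := Nat.div_le_div_right (c := 2 ^ k) (not_lt.mp hc)
    omega
  have hne : u x ≠ u y := fun h => hxy (hinj x hxN y hyN h)
  -- edges
  have ex := hedge x hx1 hxN
  have ey := hedge y hy1 hyN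
  have fx := hedge cx (by omega) hcxN
  have fy := hedge cy (by omega) hcyN
  rw [hpx] at fx
  rw [hpy] at fy
  -- the crossing statement
  have key : ∀ a a' b c : ℕ, a / 2 ^ k = b / 2 ^ k → a / 2 ^ k / 2 = a' / 2 ^ k / 2 →
      a' / 2 ^ k ≠ a / 2 ^ k → c / 2 ^ k / 2 ≠ b / 2 ^ k / 2 → E a' a → E b c →
      ((a / 2 ^ k % 2 = 0 ∧ a < b) ∨ (a / 2 ^ k % 2 = 1 ∧ b < a)) → False := by
    intro a a' b c h1 h2 h3 h4 e f hs
    rcases hs with ⟨hs, hab⟩ | ⟨hs, hab⟩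
    · have hba' : b < a' := lt_of (by omega)
      rcases Nat.lt_or_ge (c / 2 ^ k) (a / 2 ^ k) with h | h
      · have hca : c < a := lt_of h
        exact hE.2 c a b a' hca hab hba' (hE.1 _ _ f) (hE.1 _ _ e)
      · have hca : a' < c := lt_of (by omega)
        exact hE.2 a b a' c hab hba' hca (hE.1 _ _ e) f
    · have hba' : a' < b := lt_of (by omega)
      rcases Nat.lt_or_ge (c / 2 ^ k) (a / 2 ^ k) with h | h
      · have hca : c < a' := lt_of (by omega)
        exact hE.2 c a' b a hca hba' hab (hE.1 _ _ f) e
      · have hca : a < c := lt_of (by omega)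
        exact hE.2 a' b a c hba' hab hca e f
  rcases lt_or_gt_of_ne hne with h | h <;> rcases Nat.mod_two_eq_zero_or_one (u x / 2 ^ k) with m | m
  · exact key (u x) _ (u y) _ hq px.symm px' oy ex fy (Or.inl ⟨m, h⟩)
  · exact key (u y) _ (u x) _ hq.symm py.symm py' ox ey fx (Or.inr ⟨by omega, h⟩)
  · exact key (u y) _ (u x) _ hq.symm py.symm py' ox ey fx (Or.inl ⟨by omega, h⟩)
  · exact key (u x) _ (u y) _ hq px.symm px' oy ex fy (Or.inr ⟨m, h⟩)

theorem par_odd (v : ℕ) : par (2 * v + 1) = v := by unfold par; omega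
theorem par_even (v : ℕ) : par (2 * v + 2) = v := by unfold par; omega

/-- No caterpillar-free configuration stays in one level. -/
theorem no_flat {u : ℕ → ℕ} {N : ℕ} {E : ℕ → ℕ → Prop} (hE : NCRel E)
    (hinj : ∀ i < N, ∀ j < N, u i = u j → i = j)
    (hedge : ∀ i, 1 ≤ i → i < N → E (u (par i)) (u i))
    {v k : ℕ} (hvN : 8 * v + 9 < N)
    (l1 : elev u (2 * v + 1) = k + 1) (l2 : elev u (2 * v + 2) = k + 1)
    (l3 : elev u (2 * (2 * v + 1) + 1) = k + 1) (l4 : elev u (2 * (2 * v + 1) + 2) = k + 1)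
    (l5 : elev u (2 * (2 * (2 * v + 1) + 1) + 1) = k + 1)
    (l6 : elev u (2 * (2 * (2 * v + 1) + 2) + 1) = k + 1) : False := by
  have e1 := hedge (2 * v + 1) (by omega) (by omega)
  have e2 := hedge (2 * v + 2) (by omega) (by omega)
  have e3 := hedge (2 * (2 * v + 1) + 1) (by omega) (by omega)
  have e4 := hedge (2 * (2 * v + 1) + 2) (by omega) (by omega)
  have e5 := hedge (2 * (2 * (2 * v + 1) + 1) + 1) (by omega) (by omega)
  have e6 := hedge (2 * (2 * (2 * v + 1) + 2) + 1) (by omega) (by omega)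
  have s1 := lev_split l1
  have s2 := lev_split l2
  have s3 := lev_split l3
  have s4 := lev_split l4
  have s5 := lev_split l5
  have s6 := lev_split l6
  rw [par_odd] at e1 e3 e5 e6 s1 s3 s5 s6
  rw [par_even] at e2 e4 s2 s4
  have ne : ∀ i j, i < N → j < N → i ≠ j → u i ≠ u j := fun i j hi hj hij h =>
    hij (hinj i hi j hj h)
  have n1 := ne v (2 * (2 * v + 1) + 1) (by omega) (by omega) (by omega)
  have n2 := ne v (2 * (2 * v + 1) + 2) (by omega) (by omega) (by omega)
  have n3 := ne (2 * (2 * v + 1) + 1) (2 * (2 * v + 1) + 2) (by omega) (by omega) (by omega)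
  have n4 := ne (2 * v + 2) (2 * v + 1) (by omega) (by omega) (by omega)
  have n5 := ne (2 * (2 * (2 * v + 1) + 1) + 1) (2 * v + 1) (by omega) (by omega) (by omega)
  have n6 := ne (2 * (2 * (2 * v + 1) + 2) + 1) (2 * v + 1) (by omega) (by omega) (by omega)
  generalize 2 * (2 * (2 * v + 1) + 1) + 1 = i5 at *
  generalize 2 * (2 * (2 * v + 1) + 2) + 1 = i6 at *
  generalize 2 * (2 * v + 1) + 1 = i3 at *
  generalize 2 * (2 * v + 1) + 2 = i4 at *
  generalize 2 * v + 1 = i1 at *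
  generalize 2 * v + 2 = i2 at *
  have hp : 0 < 2 ^ k := by positivity
  have lo : ∀ a m : ℕ, a / 2 ^ k = 2 * m → a < (2 * m + 1) * 2 ^ k := fun a m h =>
    (Nat.div_lt_iff_lt_mul hp).1 (by omega)
  have hi : ∀ a m : ℕ, a / 2 ^ k = 2 * m + 1 → (2 * m + 1) * 2 ^ k ≤ a := fun a m h =>
    (Nat.le_div_iff_mul_le hp).1 (by omega)
  refine spider hE (T := (2 * (u v / 2 ^ k / 2) + 1) * 2 ^ k) (c := u i1) (d1 := u v) (d2 := u i3)
    (d3 := u i4) (x1 := u i2) (x2 := u i5) (x3 := u i6) ?_ n1 n2 n3 n4 n5 n6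
    (hE.1 _ _ e1) e3 e4 e2 e5 e6
  rcases Nat.mod_two_eq_zero_or_one (u v / 2 ^ k) with m | m
  · right
    exact ⟨hi _ _ (by omega), hi _ _ (by omega), hi _ _ (by omega), hi _ _ (by omega),
      lo _ _ (by omega), lo _ _ (by omega), lo _ _ (by omega)⟩
  · left
    exact ⟨lo _ _ (by omega), lo _ _ (by omega), lo _ _ (by omega), lo _ _ (by omega),
      hi _ _ (by omega), hi _ _ (by omega), hi _ _ (by omega)⟩

theorem core {u : ℕ → ℕ} {h K : ℕ} {E : ℕ → ℕ → Prop} (hE : NCRel E)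
    (hinj : ∀ i < treeSize h, ∀ j < treeSize h, u i = u j → i = j)
    (hK : ∀ i < treeSize h, u i < 2 ^ K)
    (hedge : ∀ i, 1 ≤ i → i < treeSize h → E (u (par i)) (u i))
    (hmono : ∀ j, 3 ≤ j → j < treeSize h → elev u (par j) ≤ elev u j) :
    treeSize h ≤ 48 * K + 15 := by
  classical
  by_cases hh : h < 2
  · have : treeSize h ≤ 3 := by
      interval_cases h <;> simp [treeSize]
    omega
  obtain ⟨g, rfl⟩ : ∃ g, h = g + 2 := ⟨h - 2, by omega⟩
  have hN : treeSize (g + 2) = 8 * 2 ^ g - 1 := by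
    unfold treeSize
    rw [pow_succ, pow_succ, pow_succ]
    congr 1
    ring
  generalize treeSize (g + 2) = N at *
  have hparlt : ∀ i, 1 ≤ i → par i < i := by intro i hi; unfold par; omega
  have hbd : ∀ i, 1 ≤ i → i < N → 1 ≤ elev u i ∧ elev u i ≤ K := by
    intro i h1 hi
    have hp := hparlt i h1
    refine ⟨lev_pos fun he => ?_, lev_le_of_lt (hK _ (by omega)) (hK _ hi)⟩
    have := hinj _ (by omega) _ hi he
    omega
  set S : Finset ℕ := (Finset.range N).filter
    (fun x => 1 ≤ x ∧ ∃ c, 3 ≤ c ∧ c < N ∧ par c = x ∧ elev u x < elev u c) with hS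
  have hScard : S.card ≤ 2 * K := by
    have : S.card ≤ (Finset.Icc 1 K ×ˢ Finset.range 2).card := by
      apply Finset.card_le_card_of_injOn
        (fun x => (elev u x, u x / 2 ^ (elev u x - 1) % 2))
      · intro x hx
        simp only [hS, Finset.coe_filter, Set.mem_ofPred_eq, Finset.mem_range] at hx
        have := hbd x hx.2.1 hx.1
        simp only [Finset.coe_product, Set.mem_prod, Finset.mem_coe, Finset.mem_Icc,
          Finset.mem_range]
        exact ⟨this, Nat.mod_lt _ (by norm_num)⟩
      · intro x hx y hy hxy
        simp only [hS, Finset.coe_filter, Set.mem_ofPred_eq, Finset.mem_range] at hx hy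
        obtain ⟨hxN, hx1, cx, hcx, hcxN, hpx, hlx⟩ := hx
        obtain ⟨hyN, hy1, cy, hcy, hcyN, hpy, hly⟩ := hy
        simp only [Prod.mk.injEq] at hxy
        obtain ⟨h1, h2⟩ := hxy
        obtain ⟨k, hk⟩ : ∃ k, elev u x = k + 1 := ⟨elev u x - 1, by have := hbd x hx1 hxN; omega⟩
        rw [← h1, hk] at h2
        exact special_unique hE hinj hedge hmono hx1 hxN hy1 hyN hcx hcxN hpx hcy hcyN hpy hk
          (h1 ▸ hk) (by omega) (by omega) h2
    simpa [mul_comm] using this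
  have hsub : Finset.Icc 1 (2 ^ g - 2) ⊆ S ∪ S.image par ∪ S.image (fun x => par (par x)) := by
    intro v hv
    rw [Finset.mem_Icc] at hv
    by_contra hns
    simp only [Finset.mem_union, Finset.mem_image, not_or, not_exists, not_and] at hns
    obtain ⟨⟨ns1, ns2⟩, ns3⟩ := hns
    have flat : ∀ x, 1 ≤ x → x ∉ S → ∀ c, 3 ≤ c → c < N → par c = x → elev u c = elev u x := by
      intro x hx hxS c hc hcN hp
      by_contra hne
      apply hxS
      rw [hS, Finset.mem_filter, Finset.mem_range]
      have h1 := hmono c hc hcN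
      have h2 := hparlt c (by omega)
      rw [hp] at h1 h2
      exact ⟨by omega, hx, c, hc, hcN, hp, by omega⟩
    have hvN : 8 * v + 9 < N := by omega
    have t1 : 2 * v + 1 ∉ S := fun hm => ns2 _ hm (par_odd v)
    have t2 : 2 * (2 * v + 1) + 1 ∉ S := fun hm => ns3 _ hm (by rw [par_odd, par_odd])
    have t3 : 2 * (2 * v + 1) + 2 ∉ S := fun hm => ns3 _ hm (by rw [par_even, par_odd])
    obtain ⟨k, hk⟩ : ∃ k, elev u v = k + 1 :=
      ⟨elev u v - 1, by have := hbd v hv.1 (by omega); omega⟩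
    have l1 := flat v hv.1 ns1 (2 * v + 1) (by omega) (by omega) (par_odd _)
    have l2 := flat v hv.1 ns1 (2 * v + 2) (by omega) (by omega) (par_even _)
    have l3 := flat _ (by omega) t1 (2 * (2 * v + 1) + 1) (by omega) (by omega) (par_odd _)
    have l4 := flat _ (by omega) t1 (2 * (2 * v + 1) + 2) (by omega) (by omega) (par_even _)
    have l5 := flat _ (by omega) t2 (2 * (2 * (2 * v + 1) + 1) + 1) (by omega) (by omega)
      (par_odd _)
    have l6 := flat _ (by omega) t3 (2 * (2 * (2 * v + 1) + 2) + 1) (by omega) (by omega)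
      (par_odd _)
    exact no_flat hE hinj hedge (k := k) hvN (by omega) (by omega) (by omega) (by omega)
      (by omega) (by omega)
  have c1 := Finset.card_le_card hsub
  have c2 := Finset.card_union_le (S ∪ S.image par) (S.image (fun x => par (par x)))
  have c3 := Finset.card_union_le S (S.image par)
  have c4 : (S.image par).card ≤ S.card := Finset.card_image_le
  have c5 : (S.image (fun x => par (par x))).card ≤ S.card := Finset.card_image_le
  rw [Nat.card_Icc] at c1
  omega

/-! ### Geometry -/

/-- Orientation determinant of three points. -/
def orient (a b c : Pt) : ℝ := (b.1 - a.1) * (c.2 - a.2) - (b.2 - a.2) * (c.1 - a.1)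

theorem mem_segment_of_weights {p q x : Pt} {s t : ℝ} (hs : 0 ≤ s) (ht : 0 ≤ t) (hst : 0 < s + t)
    (h1 : (s + t) * x.1 = s * p.1 + t * q.1) (h2 : (s + t) * x.2 = s * p.2 + t * q.2) :
    x ∈ segment ℝ p q := by
  refine ⟨s / (s + t), t / (s + t), by positivity, by positivity, by field_simp, ?_⟩
  ext
  · simp only [Prod.fst_add, Prod.smul_fst, smul_eq_mul]
    field_simp
    linarith
  · simp only [Prod.snd_add, Prod.smul_snd, smul_eq_mul]
    field_simp
    linarith

theorem segments_meet {a b c d : Pt} (h1 : 0 < orient b c d) (h2 : 0 < orient a b d)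
    (h3 : 0 < orient a c d) (h4 : 0 < orient a b c) :
    ∃ x, x ∈ segment ℝ a c ∧ x ∈ segment ℝ b d := by
  have hsum : orient b c d + orient a b d = orient a c d + orient a b c := by
    unfold orient; ring
  have hx : orient b c d * a.1 + orient a b d * c.1 =
      orient a c d * b.1 + orient a b c * d.1 := by unfold orient; ring
  have hy : orient b c d * a.2 + orient a b d * c.2 =
      orient a c d * b.2 + orient a b c * d.2 := by unfold orient; ring
  have hpos : 0 < orient b c d + orient a b d := by linarith
  refine ⟨((orient b c d * a.1 + orient a b d * c.1) / (orient b c d + orient a b d),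
    (orient b c d * a.2 + orient a b d * c.2) / (orient b c d + orient a b d)), ?_, ?_⟩
  · apply mem_segment_of_weights h1.le h2.le hpos
    · field_simp
    · field_simp
  · apply mem_segment_of_weights h3.le h4.le (by linarith)
    · rw [← hsum]
      field_simp
      linarith
    · rw [← hsum]
      field_simp
      linarith

theorem mem_triangle {p a b d : Pt} (h1 : 0 < orient p a b) (h2 : 0 < orient p b d)
    (h3 : 0 < orient p a d) (h4 : orient a b d ≤ 0) {s : Set Pt} (hp : p ∈ s) (ha : a ∈ s)
    (hd : d ∈ s) : b ∈ convexHull ℝ s := by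
  have hc := convex_convexHull ℝ s
  have hp' := subset_convexHull ℝ s hp
  have ha' := subset_convexHull ℝ s ha
  have hd' := subset_convexHull ℝ s hd
  set D := orient p a d with hD
  have hsum : -orient a b d + orient p b d + orient p a b = D := by
    rw [hD]; unfold orient; ring
  have hx : -orient a b d * p.1 + orient p b d * a.1 + orient p a b * d.1 = D * b.1 := by
    rw [hD]; unfold orient; ring
  have hy : -orient a b d * p.2 + orient p b d * a.2 + orient p a b * d.2 = D * b.2 := by
    rw [hD]; unfold orient; ring
  have hb : b = (-orient a b d / D) • p + (orient p b d / D) • a + (orient p a b / D) • d := by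
    ext
    · simp only [Prod.fst_add, Prod.smul_fst, smul_eq_mul]
      field_simp
      linarith
    · simp only [Prod.snd_add, Prod.smul_snd, smul_eq_mul]
      field_simp
      linarith
  rw [hb]
  have := hc.sum_mem (t := Finset.univ)
    (w := ![-orient a b d / D, orient p b d / D, orient p a b / D]) (z := ![p, a, d]) ?_ ?_ ?_
  · simpa [Fin.sum_univ_three] using this
  · intro i _
    have : 0 ≤ -orient a b d / D := div_nonneg (by linarith) h3.le
    fin_cases i <;> simp
    all_goals positivity
  · simp only [Fin.sum_univ_three]
    simp
    field_simp
    linarith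
  · intro i _
    fin_cases i <;> simp <;> assumption

/-- A real key on the points of a set in convex position, such that all triples in increasing
order of the key are positively oriented. -/
theorem exists_key (P : Finset Pt) (hP : ConvexPosition ↑P) :
    ∃ κ : Pt → ℝ, (∀ p ∈ P, ∀ q ∈ P, κ p = κ q → p = q) ∧
      ∀ a ∈ P, ∀ b ∈ P, ∀ c ∈ P, κ a < κ b → κ b < κ c → 0 < orient a b c := by
  classical
  rcases P.eq_empty_or_nonempty with rfl | ⟨p, hp⟩
  · exact ⟨fun _ => 0, by simp, by simp⟩
  have hcl : IsClosed (convexHull ℝ ((P : Set Pt) \ {p})) :=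
    (Set.Finite.isCompact_convexHull ℝ (P.finite_toSet.subset Set.sdiff_subset)).isClosed
  obtain ⟨f, w, hf1, hf2⟩ :=
    geometric_hahn_banach_point_closed (convex_convexHull ℝ _) hcl (hP p hp)
  set α := f (1, 0) with hα
  set β := f (0, 1) with hβ
  have hfv : ∀ v : Pt, f v = α * v.1 + β * v.2 := by
    intro v
    have : v = v.1 • ((1 : ℝ), (0 : ℝ)) + v.2 • ((0 : ℝ), (1 : ℝ)) := by
      ext <;> simp
    conv_lhs => rw [this]
    rw [map_add, map_smul, map_smul, smul_eq_mul, smul_eq_mul]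
    ring
  have hfpos : ∀ q ∈ P, q ≠ p → 0 < α * (q.1 - p.1) + β * (q.2 - p.2) := by
    intro q hq hqp
    have := hf2 q (subset_convexHull ℝ _ ⟨hq, hqp⟩)
    rw [hfv] at this hf1
    linarith
  set F : Pt → ℝ := fun q => α * (q.1 - p.1) + β * (q.2 - p.2) with hF
  set G : Pt → ℝ := fun q => α * (q.2 - p.2) - β * (q.1 - p.1) with hG
  set s : Pt → ℝ := fun q => G q / F q with hs
  have hdet : ∀ q r, F q * G r - G q * F r = (α ^ 2 + β ^ 2) * orient p q r := by
    intro q r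
    simp only [hF, hG]
    unfold orient
    ring
  have hdet2 : ∀ q ∈ P, q ≠ p → ∀ r ∈ P, r ≠ p →
      (α ^ 2 + β ^ 2) * orient p q r = F q * F r * (s r - s q) := by
    intro q hq hqp r hr hrp
    have h1 : F q ≠ 0 := (hfpos q hq hqp).ne'
    have h2 : F r ≠ 0 := (hfpos r hr hrp).ne'
    rw [← hdet]
    simp only [hs]
    field_simp
    try ring
  have hor : ∀ q ∈ P, q ≠ p → ∀ r ∈ P, r ≠ p → s q < s r → 0 < orient p q r := by
    intro q hq hqp r hr hrp hlt
    have h1 : 0 < F q := hfpos q hq hqp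
    have h2 : 0 < F r := hfpos r hr hrp
    have h3 : 0 < F q * F r * (s r - s q) := by
      have : 0 < s r - s q := by linarith
      positivity
    rw [← hdet2 q hq hqp r hr hrp] at h3
    exact pos_of_mul_pos_right h3 (by positivity)
  have hab : ∀ q ∈ P, q ≠ p → 0 < α ^ 2 + β ^ 2 := by
    intro q hq hqp
    have h1 : 0 < α * (q.1 - p.1) + β * (q.2 - p.2) := hfpos q hq hqp
    by_contra hc
    have ha : α = 0 := by nlinarith [sq_nonneg α, sq_nonneg β]
    have hb : β = 0 := by nlinarith [sq_nonneg α, sq_nonneg β]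
    rw [ha, hb] at h1
    simp at h1
  -- `s` is injective away from `p`
  have hsinj0 : ∀ q ∈ P, q ≠ p → ∀ r ∈ P, r ≠ p → s q = s r → F q ≤ F r → q = r := by
    intro q hq hqp r hr hrp he hle
    by_contra hne
    have h1 : 0 < F q := hfpos q hq hqp
    have h2 : 0 < F r := hfpos r hr hrp
    have hG1 : G q = s q * F q := by simp only [hs]; field_simp
    have hG2 : G r = s q * F r := by rw [he]; simp only [hs]; field_simp
    have hpos := hab q hq hqp
    apply hP q hq
    have hmem : q ∈ segment ℝ p r := by
      apply mem_segment_of_weights (s := F r - F q) (t := F q) (by linarith) h1.le (by linarith)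
      · have : (α ^ 2 + β ^ 2) * (F r * (q.1 - p.1)) = (α ^ 2 + β ^ 2) * (F q * (r.1 - p.1)) := by
          have e1 : (α ^ 2 + β ^ 2) * (q.1 - p.1) = α * F q - β * G q := by
            simp only [hF, hG]; ring
          have e2 : (α ^ 2 + β ^ 2) * (r.1 - p.1) = α * F r - β * G r := by
            simp only [hF, hG]; ring
          calc _ = F r * ((α ^ 2 + β ^ 2) * (q.1 - p.1)) := by ring
            _ = F q * ((α ^ 2 + β ^ 2) * (r.1 - p.1)) := by rw [e1, e2, hG1, hG2]; ring
            _ = _ := by ring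
        have := mul_left_cancel₀ hpos.ne' this
        linarith
      · have : (α ^ 2 + β ^ 2) * (F r * (q.2 - p.2)) = (α ^ 2 + β ^ 2) * (F q * (r.2 - p.2)) := by
          have e1 : (α ^ 2 + β ^ 2) * (q.2 - p.2) = β * F q + α * G q := by
            simp only [hF, hG]; ring
          have e2 : (α ^ 2 + β ^ 2) * (r.2 - p.2) = β * F r + α * G r := by
            simp only [hF, hG]; ring
          calc _ = F r * ((α ^ 2 + β ^ 2) * (q.2 - p.2)) := by ring
            _ = F q * ((α ^ 2 + β ^ 2) * (r.2 - p.2)) := by rw [e1, e2, hG1, hG2]; ring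
            _ = _ := by ring
        have := mul_left_cancel₀ hpos.ne' this
        linarith
    exact segment_subset_convexHull (s := (P : Set Pt) \ {q}) ⟨hp, fun h => hqp h.symm⟩
      ⟨hr, fun h => hne h.symm⟩ hmem
  have hsinj : ∀ q ∈ P, q ≠ p → ∀ r ∈ P, r ≠ p → s q = s r → q = r := by
    intro q hq hqp r hr hrp he
    rcases le_total (F q) (F r) with h | h
    · exact hsinj0 q hq hqp r hr hrp he h
    · exact (hsinj0 r hr hrp q hq hqp he.symm h).symm
  obtain ⟨B, hB⟩ : ∃ B, ∀ q ∈ P, B < s q := by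
    obtain ⟨B, hB⟩ := (P.finite_toSet.image s).bddBelow
    refine ⟨B - 1, fun q hq => ?_⟩
    have := hB (Set.mem_image_of_mem s hq)
    linarith
  refine ⟨fun q => if q = p then B else s q, ?_, ?_⟩
  · intro q hq r hr h
    by_cases h1 : q = p <;> by_cases h2 : r = p
    · rw [h1, h2]
    · simp only [h1, h2, if_true, if_false] at h
      have := hB r hr
      linarith
    · simp only [h1, h2, if_true, if_false] at h
      have := hB q hq
      linarith
    · simp only [h1, h2, if_false] at h
      exact hsinj q hq h1 r hr h2 h
  · intro a ha b hb c hc h1 h2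
    have hbp : b ≠ p := by
      rintro rfl
      simp only [if_true] at h1
      have := hB a ha
      split_ifs at h1 <;> linarith
    have hcp : c ≠ p := by
      rintro rfl
      simp only [if_true] at h2
      have := hB b hb
      split_ifs at h2 <;> linarith
    simp only [hbp, hcp, if_false] at h1 h2
    have hbc := hor b hb hbp c hc hcp h2
    by_cases hap : a = p
    · rw [hap]; exact hbc
    simp only [hap, if_false] at h1
    by_contra hneg
    apply hP b hb
    refine mem_triangle (hor a ha hap b hb hbp h1) hbc (hor a ha hap c hc hcp (h1.trans h2))
      (not_lt.mp hneg) ⟨hp, fun h => hbp h.symm⟩ ⟨ha, ?_⟩ ⟨hc, ?_⟩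
    · rintro rfl
      exact lt_irrefl _ h1
    · rintro rfl
      exact lt_irrefl _ h2

/-- Convex position gives an integer indexing in which interleaved chords meet. -/
theorem exists_index (P : Finset Pt) (hP : ConvexPosition ↑P) :
    ∃ ι : Pt → ℕ, (∀ p ∈ P, ι p < P.card) ∧ (∀ p ∈ P, ∀ q ∈ P, ι p = ι q → p = q) ∧
      ∀ a ∈ P, ∀ b ∈ P, ∀ c ∈ P, ∀ d ∈ P, ι a < ι b → ι b < ι c → ι c < ι d →
        ∃ x, x ∈ segment ℝ a c ∧ x ∈ segment ℝ b d := by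
  classical
  obtain ⟨κ, hκ, hor⟩ := exists_key P hP
  have hlt : ∀ p ∈ P, ∀ q ∈ P, κ p < κ q →
      (P.filter (fun r => κ r < κ p)).card < (P.filter (fun r => κ r < κ q)).card := by
    intro p hp q hq h
    apply Finset.card_lt_card
    rw [Finset.ssubset_iff_of_subset]
    · exact ⟨p, by simp [hp, h], by simp⟩
    · intro r hr
      rw [Finset.mem_filter] at hr ⊢
      exact ⟨hr.1, hr.2.trans h⟩
  have hlt' : ∀ p ∈ P, ∀ q ∈ P,
      (P.filter (fun r => κ r < κ p)).card < (P.filter (fun r => κ r < κ q)).card → κ p < κ q := by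
    intro p hp q hq h
    by_contra hc
    rcases eq_or_lt_of_le (not_lt.mp hc) with h1 | h1
    · rw [h1] at h
      exact lt_irrefl _ h
    · have := hlt q hq p hp h1
      omega
  refine ⟨fun p => (P.filter (fun r => κ r < κ p)).card, ?_, ?_, ?_⟩
  · intro p hp
    apply Finset.card_lt_card
    rw [Finset.ssubset_iff_of_subset (Finset.filter_subset _ _)]
    exact ⟨p, hp, by simp⟩
  · intro p hp q hq h
    apply hκ p hp q hq
    rcases lt_trichotomy (κ p) (κ q) with h1 | h1 | h1
    · have := hlt p hp q hq h1
      simp only at h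
      omega
    · exact h1
    · have := hlt q hq p hp h1
      simp only at h
      omega
  · intro a ha b hb c hc d hd h1 h2 h3
    have k1 := hlt' a ha b hb h1
    have k2 := hlt' b hb c hc h2
    have k3 := hlt' c hc d hd h3
    exact segments_meet (hor b hb c hc d hd k2 k3) (hor a ha b hb d hd k1 (k2.trans k3))
      (hor a ha c hc d hd (k1.trans k2) k3) (hor a ha b hb c hc k1 k2)

/-! ### The edge labels -/

/-- Natural-number labels: first the level, then a symmetric tie-breaker. -/
noncomputable def natLabel (n i j : ℕ) : ℕ := lev i j * (n * n) + (min i j * n + max i j)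

theorem tie_lt {n i j : ℕ} (hi : i < n) (hj : j < n) : min i j * n + max i j < n * n := by
  have h1 : min i j + 1 ≤ n := by omega
  have h2 : max i j < n := by omega
  calc min i j * n + max i j < min i j * n + n := by omega
    _ = (min i j + 1) * n := by ring
    _ ≤ n * n := Nat.mul_le_mul_right _ h1

theorem natLabel_comm (n i j : ℕ) : natLabel n i j = natLabel n j i := by
  unfold natLabel
  rw [lev_comm, min_comm, max_comm]

theorem natLabel_inj {n i j k l : ℕ} (hi : i < n) (hj : j < n) (hk : k < n) (hl : l < n)
    (h : natLabel n i j = natLabel n k l) : min i j = min k l ∧ max i j = max k l := by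
  have h1 := congrArg (fun x => x % (n * n)) h
  simp only [natLabel] at h1
  rw [Nat.mul_add_mod_of_lt (tie_lt hi hj), Nat.mul_add_mod_of_lt (tie_lt hk hl)] at h1
  have a1 : max i j < n := by omega
  have a2 : max k l < n := by omega
  have h2 := congrArg (fun x => x % n) h1
  have h3 := congrArg (fun x => x / n) h1
  have hn : 0 < n := by omega
  rw [Nat.mul_add_mod_of_lt a1, Nat.mul_add_mod_of_lt a2] at h2
  rw [mul_comm, Nat.mul_add_div hn, Nat.div_eq_of_lt a1, mul_comm, Nat.mul_add_div hn,
    Nat.div_eq_of_lt a2] at h3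
  exact ⟨by omega, h2⟩

theorem natLabel_lt {n i j k l : ℕ} (hk : k < n) (hl : l < n)
    (h : natLabel n i j < natLabel n k l) : lev i j ≤ lev k l := by
  by_contra hc
  have h1 : (lev k l + 1) * (n * n) ≤ lev i j * (n * n) := Nat.mul_le_mul_right _ (by omega)
  have h2 := tie_lt hk hl
  unfold natLabel at h
  rw [add_mul, one_mul] at h1
  omega

/-- `τ̄₊(Kₙ) = O(log n)`: there is `C > 0` such that for every set of
`n ≥ 2` points in convex position there is an edge-ordering of the complete geometric
graph under which every non-crossing increasing embedded complete binary tree has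
size at most `C·log n`. -/
theorem stmt7 : ∃ C : ℝ, 0 < C ∧
    ∀ n : ℕ, 2 ≤ n → ∀ P : Finset Pt, P.card = n → ConvexPosition ↑P →
      ∃ φ : Pt → Pt → ℝ, EdgeOrderOn P φ ∧
        ∀ (h : ℕ) (t : ℕ → Pt), TreeEmbed P h t → TreeNonCross h t →
          TreeIncreasing φ h t → (treeSize h : ℝ) ≤ C * Real.log n := by
  refine ⟨200, by norm_num, ?_⟩
  intro n hn P hcard hP
  obtain ⟨ι, hι1, hι2, hι3⟩ := exists_index P hP
  rw [hcard] at hι1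
  refine ⟨fun p q => (natLabel n (ι p) (ι q) : ℝ), ⟨?_, ?_⟩, ?_⟩
  · intro p q
    simp only [natLabel_comm]
  · intro p hp q hq r hr s hs hpq hrs h
    simp only at h
    have h' : natLabel n (ι p) (ι q) = natLabel n (ι r) (ι s) := by exact_mod_cast h
    obtain ⟨h1, h2⟩ := natLabel_inj (hι1 p hp) (hι1 q hq) (hι1 r hr) (hι1 s hs) h'
    have : (ι p = ι r ∧ ι q = ι s) ∨ (ι p = ι s ∧ ι q = ι r) := by omega
    rcases this with ⟨a, b⟩ | ⟨a, b⟩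
    · rw [hι2 p hp r hr a, hι2 q hq s hs b]
    · rw [hι2 p hp s hs a, hι2 q hq r hr b, Set.pair_comm]
  · intro h t hemb hnc hinc
    obtain ⟨hmem, htinj⟩ := hemb
    have hparlt : ∀ i, 1 ≤ i → par i < i := by intro i hi; unfold par; omega
    set K := Nat.log 2 n + 1 with hK
    have hnK : n < 2 ^ K := Nat.lt_pow_succ_log_self (by norm_num) n
    have main : treeSize h ≤ 48 * K + 15 := by
      apply core (u := fun i => ι (t i))
        (E := fun a b => ∃ i, 1 ≤ i ∧ i < treeSize h ∧
          ((a = ι (t (par i)) ∧ b = ι (t i)) ∨ (a = ι (t i) ∧ b = ι (t (par i)))))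
      · constructor
        · rintro a b ⟨i, h1, h2, h3⟩
          exact ⟨i, h1, h2, by tauto⟩
        · rintro a b c d hab hbc hcd ⟨i, hi1, hi2, hi3⟩ ⟨j, hj1, hj2, hj3⟩
          have hij : i ≠ j := by
            rintro rfl
            omega
          have hno := hnc i hi1 hi2 j hj1 hj2 hij
          have m1 := hmem i hi2
          have m2 := hmem (par i) (by have := hparlt i hi1; omega)
          have m3 := hmem j hj2
          have m4 := hmem (par j) (by have := hparlt j hj1; omega)
          have fin : ∀ x, x ∈ segment ℝ (t (par i)) (t i) → x ∈ segment ℝ (t (par j)) (t j) →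
              False := by
            intro x hx1 hx2
            obtain ⟨y1, y2⟩ := hno x hx1 hx2
            rcases y1 with y1 | y1 <;> rcases y2 with y2 | y2 <;>
              · have := congrArg ι (y1.symm.trans y2)
                omega
          rcases hi3 with ⟨rfl, rfl⟩ | ⟨rfl, rfl⟩ <;> rcases hj3 with ⟨rfl, rfl⟩ | ⟨rfl, rfl⟩
          · obtain ⟨x, x1, x2⟩ := hι3 _ m2 _ m4 _ m1 _ m3 hab hbc hcd
            exact fin x x1 x2
          · obtain ⟨x, x1, x2⟩ := hι3 _ m2 _ m3 _ m1 _ m4 hab hbc hcd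
            exact fin x x1 (by rw [segment_symm]; exact x2)
          · obtain ⟨x, x1, x2⟩ := hι3 _ m1 _ m4 _ m2 _ m3 hab hbc hcd
            exact fin x (by rw [segment_symm]; exact x1) x2
          · obtain ⟨x, x1, x2⟩ := hι3 _ m1 _ m3 _ m2 _ m4 hab hbc hcd
            exact fin x (by rw [segment_symm]; exact x1) (by rw [segment_symm]; exact x2)
      · intro i hi j hj he
        exact htinj i hi j hj (hι2 _ (hmem i hi) _ (hmem j hj) he)
      · intro i hi
        exact (hι1 _ (hmem i hi)).trans hnK
      · intro i h1 h2
        exact ⟨i, h1, h2, Or.inl ⟨rfl, rfl⟩⟩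
      · intro j h3 hj
        have hl := hinc j h3 hj
        simp only at hl
        have hl' : natLabel n (ι (t (par (par j)))) (ι (t (par j))) <
            natLabel n (ι (t (par j))) (ι (t j)) := by exact_mod_cast hl
        have hp := hparlt j (by omega)
        exact natLabel_lt (hι1 _ (hmem _ (by omega))) (hι1 _ (hmem _ hj)) hl'
    have hlog1 : (Nat.log 2 n : ℝ) * Real.log 2 ≤ Real.log n := by
      rw [← Real.log_pow]
      apply Real.log_le_log (by positivity)
      exact_mod_cast Nat.pow_log_le_self 2 (by omega)
    have hl1 : (1 : ℝ) ≤ Nat.log 2 n := by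
      exact_mod_cast Nat.log_pos (by norm_num) hn
    have h2 := Real.log_two_gt_d9
    have main' : (treeSize h : ℝ) ≤ 48 * ((Nat.log 2 n : ℝ) + 1) + 15 := by
      have : (treeSize h : ℝ) ≤ ((48 * K + 15 : ℕ) : ℝ) := by exact_mod_cast main
      rw [hK] at this
      push_cast at this
      exact this
    nlinarith
end
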